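/- Let (Ω, F, P) be a probability space, ρ ∈ [0,1), and 0 < t₁ < t₂ ≤ t. Let X, Y₁, Y₂ : Ω → ℝ be random variables such that the law of ω ↦ (X(ω), Y₁(ω), Y₂(ω)) on ℝ³ is a centered Gaussian measure with E[X²] = t, E[Y₁²] = t₁, E[Y₂²] = t₂, E[X·Y₁] = t₁, E[X·Y₂] = ρ·t₂, and E[Y₁·Y₂] = ρ·t₁. Then the conditional expectation of X given the σ-algebra generated by (Y₁, Y₂) satisfies, almost surely, E[X | σ(Y₁, Y₂)] = G·Y₁ + Q·Y₂, where G = (1−ρ²)t₂/(t₂ − ρ²t₁) and Q = ρ(t₂ − t₁)/(t₂ − ρ²t₁). -/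

import Mathlib

open MeasureTheory ProbabilityTheory

/-- The characteristic function of `X` at a dual vector `L` such that `L ∘ X` is a centered
Gaussian. -/
lemma charFunDual_map_of_map_comp_eq_gaussianReal {Ω E : Type*} [MeasurableSpace Ω]
    [NormedAddCommGroup E] [NormedSpace ℝ E] [MeasurableSpace E] [BorelSpace E]
    {P : Measure Ω} {X : Ω → E} (hX : Measurable X) (L : StrongDual ℝ E) {v : NNReal}
    (h : P.map (fun ω => L (X ω)) = gaussianReal 0 v) :
    charFunDual (P.map X) L = Complex.exp (-v / 2) := by
  rw [charFunDual_eq_charFun_map_one, Measure.map_map (by fun_prop) hX]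
  change charFun (P.map (fun ω => L (X ω))) 1 = _
  rw [h, charFun_gaussianReal]
  simp [neg_div]

/-- Centered Gaussian variables whose variances add up in every direction are independent. -/
lemma indepFun_of_forall_map_eq_gaussianReal_add {Ω E F : Type*} [MeasurableSpace Ω]
    [NormedAddCommGroup E] [NormedSpace ℝ E] [MeasurableSpace E] [BorelSpace E]
    [CompleteSpace E] [SecondCountableTopology E]
    [NormedAddCommGroup F] [NormedSpace ℝ F] [MeasurableSpace F] [BorelSpace F]
    [CompleteSpace F] [SecondCountableTopology F]
    {P : Measure Ω} [IsProbabilityMeasure P] {X : Ω → E} {Y : Ω → F}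
    (hX : Measurable X) (hY : Measurable Y)
    (h : ∀ L : StrongDual ℝ (E × F), ∃ v w : NNReal,
      P.map (fun ω => L (X ω, 0)) = gaussianReal 0 v ∧
      P.map (fun ω => L (0, Y ω)) = gaussianReal 0 w ∧
      P.map (fun ω => L (X ω, Y ω)) = gaussianReal 0 (v + w)) :
    IndepFun X Y P := by
  rw [indepFun_iff_charFunDual_prod hX.aemeasurable hY.aemeasurable]
  intro L
  obtain ⟨v, w, hv, hw, hvw⟩ := h L
  rw [charFunDual_map_of_map_comp_eq_gaussianReal (hX.prodMk hY) L hvw,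
    charFunDual_map_of_map_comp_eq_gaussianReal hX (L.comp (.inl ℝ E F)) (v := v)
      (by simpa using hv),
    charFunDual_map_of_map_comp_eq_gaussianReal hY (L.comp (.inr ℝ E F)) (v := w)
      (by simpa using hw),
    ← Complex.exp_add]
  congr 1
  push_cast
  ring

/-- If `X - f ∘ Y` has mean zero and is independent of `Y`, then `f ∘ Y` is the conditional
expectation of `X` given `Y`. -/
lemma condExp_comap_eq_of_indepFun_sub {Ω F : Type*} {mΩ : MeasurableSpace Ω}
    {mF : MeasurableSpace F} {P : Measure Ω} [IsProbabilityMeasure P] {X : Ω → ℝ} {Y : Ω → F}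
    {f : F → ℝ} (hX : Measurable X) (hY : Measurable Y) (hf : Measurable f)
    (hXint : Integrable X P) (hfint : Integrable (fun ω => f (Y ω)) P)
    (hmean : ∫ ω, X ω - f (Y ω) ∂P = 0)
    (hindep : IndepFun (fun ω => X ω - f (Y ω)) Y P) :
    P[X | mF.comap Y] =ᵐ[P] fun ω => f (Y ω) := by
  have hZ : P[fun ω => X ω - f (Y ω) | mF.comap Y] =ᵐ[P]
      fun _ => ∫ ω, X ω - f (Y ω) ∂P :=
    condExp_indep_eq (hX.sub (hf.comp hY)).comap_le hY.comap_le
      (comap_measurable _).stronglyMeasurable hindep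
  have hW : P[fun ω => f (Y ω) | mF.comap Y] = fun ω => f (Y ω) :=
    condExp_of_stronglyMeasurable hY.comap_le
      (hf.comp (comap_measurable Y)).stronglyMeasurable hfint
  have hsub := condExp_sub hXint hfint (mF.comap Y)
  filter_upwards [hZ, hsub] with ω h₁ h₂
  rw [hmean] at h₁
  have h₃ : P[fun ω => X ω - f (Y ω) | mF.comap Y] ω =
    P[X | mF.comap Y] ω - P[fun ω => f (Y ω) | mF.comap Y] ω := h₂
  rw [hW] at h₃
  linarith

/-- Theorem 1, stale-source case (MMSE fusion estimator for correlated Wiener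
processes): if `(X, Y₁, Y₂)` is a centered jointly Gaussian triple (every linear
combination is a centered real Gaussian) with `E[X²] = t`, `E[Y₁²] = t₁`,
`E[Y₂²] = t₂`, `E[X Y₁] = t₁`, `E[X Y₂] = ρ t₂`, `E[Y₁ Y₂] = ρ t₁`, where
`0 < t₁ < t₂ ≤ t` and `ρ ∈ [0,1)`, then almost surely
`E[X | σ(Y₁, Y₂)] = G·Y₁ + Q·Y₂` with `G = (1−ρ²)t₂/(t₂ − ρ²t₁)` and
`Q = ρ(t₂ − t₁)/(t₂ − ρ²t₁)`. -/
theorem mmse_fusion_stale_source {Ω : Type*} [MeasurableSpace Ω]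
    (P : Measure Ω) [IsProbabilityMeasure P]
    (ρ t₁ t₂ t : ℝ) (hρ0 : 0 ≤ ρ) (hρ1 : ρ < 1)
    (ht₁ : 0 < t₁) (h12 : t₁ < t₂) (h2t : t₂ ≤ t)
    (X Y₁ Y₂ : Ω → ℝ) (hX : Measurable X) (hY₁ : Measurable Y₁) (hY₂ : Measurable Y₂)
    (hGauss : ∀ a b c : ℝ,
      Measure.map (fun ω => a * X ω + b * Y₁ ω + c * Y₂ ω) P =
        gaussianReal 0 (Real.toNNReal
          (a ^ 2 * t + b ^ 2 * t₁ + c ^ 2 * t₂ +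
            2 * a * b * t₁ + 2 * a * c * (ρ * t₂) + 2 * b * c * (ρ * t₁)))) :
    P[X | MeasurableSpace.comap (fun ω => (Y₁ ω, Y₂ ω)) inferInstance] =ᵐ[P]
      fun ω => (1 - ρ ^ 2) * t₂ / (t₂ - ρ ^ 2 * t₁) * Y₁ ω +
        ρ * (t₂ - t₁) / (t₂ - ρ ^ 2 * t₁) * Y₂ ω := by
  have hLin : ∀ a b c : ℝ, Integrable (fun ω => a * X ω + b * Y₁ ω + c * Y₂ ω) P := by
    intro a b c
    have h := (memLp_id_gaussianReal (μ := 0) (v := Real.toNNReal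
      (a ^ 2 * t + b ^ 2 * t₁ + c ^ 2 * t₂ + 2 * a * b * t₁ + 2 * a * c * (ρ * t₂) +
        2 * b * c * (ρ * t₁))) 1).integrable (by simp)
    rw [← hGauss a b c] at h
    exact h.comp_measurable (by fun_prop)
  have hmean : ∀ a b c : ℝ, ∫ ω, a * X ω + b * Y₁ ω + c * Y₂ ω ∂P = 0 := by
    intro a b c
    rw [← integral_map (f := fun x : ℝ => x) (by fun_prop) (by fun_prop), hGauss,
      integral_id_gaussianReal]
  have hρ : ρ ^ 2 < 1 := by nlinarith
  have hD : 0 < t₂ - ρ ^ 2 * t₁ := by nlinarith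
  set G := (1 - ρ ^ 2) * t₂ / (t₂ - ρ ^ 2 * t₁) with hG
  set Q := ρ * (t₂ - t₁) / (t₂ - ρ ^ 2 * t₁) with hQ
  -- The normal equations: the residual is uncorrelated with both samples.
  have hn₁ : G * t₁ + Q * (ρ * t₁) = t₁ := by rw [hG, hQ]; field_simp; ring
  have hn₂ : G * (ρ * t₁) + Q * t₂ = ρ * t₂ := by rw [hG, hQ]; field_simp; ring
  have hres : 0 ≤ t - G * t₁ - Q * (ρ * t₂) := by
    have : t - G * t₁ - Q * (ρ * t₂) =
        (t - t₂) + t₂ * (t₂ - t₁) * (1 - ρ ^ 2) / (t₂ - ρ ^ 2 * t₁) := by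
      rw [hG, hQ]; field_simp; ring
    rw [this]
    have h₁ : 0 ≤ t₂ - t₁ := by linarith
    have h₂ : 0 ≤ 1 - ρ ^ 2 := by linarith
    have h₃ : 0 ≤ t₂ := by linarith
    have h₄ : 0 ≤ t - t₂ := by linarith
    positivity
  refine condExp_comap_eq_of_indepFun_sub (f := fun y : ℝ × ℝ => G * y.1 + Q * y.2)
    hX (hY₁.prodMk hY₂) (by fun_prop) (by simpa using hLin 1 0 0) (by simpa using hLin 0 G Q)
    ?_ ?_
  · rw [← hmean 1 (-G) (-Q)]
    congr 1 with ω
    ring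
  · refine indepFun_of_forall_map_eq_gaussianReal_add (by fun_prop) (by fun_prop) fun L => ?_
    obtain ⟨p, q, r, hL⟩ : ∃ p q r : ℝ, ∀ x y z, L (x, (y, z)) = p * x + q * y + r * z := by
      refine ⟨L (1, (0, 0)), L (0, (1, 0)), L (0, (0, 1)), fun x y z => ?_⟩
      have : ((x, (y, z)) : ℝ × ℝ × ℝ) =
          x • (1, (0, 0)) + y • (0, (1, 0)) + z • (0, (0, 1)) := by simp
      rw [this, map_add, map_add, map_smul, map_smul, map_smul]
      simp only [smul_eq_mul]
      ring
    have hA : 0 ≤ p ^ 2 * (t - G * t₁ - Q * (ρ * t₂)) := by positivity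
    have hB : 0 ≤ q ^ 2 * t₁ + r ^ 2 * t₂ + 2 * q * r * (ρ * t₁) := by
      have : 0 ≤ t₁ * (q + ρ * r) ^ 2 + r ^ 2 * (t₂ - ρ ^ 2 * t₁) := by positivity
      linarith
    refine ⟨_, _, ?_, ?_, (?_ : _ = gaussianReal 0 (Real.toNNReal
      (p ^ 2 * (t - G * t₁ - Q * (ρ * t₂))) + Real.toNNReal
      (q ^ 2 * t₁ + r ^ 2 * t₂ + 2 * q * r * (ρ * t₁))))⟩
    · convert hGauss p (-p * G) (-p * Q) using 2
      · ext ω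
        rw [show (0 : ℝ × ℝ) = (0, 0) from rfl, hL]
        ring
      · congr 1
        linear_combination (-p ^ 2 * G) * hn₁ - p ^ 2 * Q * hn₂
    · convert hGauss 0 q r using 2
      · ext ω
        rw [hL]
        ring
      · congr 1
        ring
    · rw [← Real.toNNReal_add hA hB]
      convert hGauss p (q - p * G) (r - p * Q) using 2
      · ext ω
        rw [hL]
        ring
      · congr 1
        linear_combination (2 * p * q - p ^ 2 * G) * hn₁ + (2 * p * r - p ^ 2 * Q) * hn₂
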